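/- arXiv:2305.12177 — 3 statements merged into one kernel-verified Lean document; each statement's English description precedes it below -/
import Mathlib

section
/- Let v be a pre-poloidal field (v = x g + ∇f with f, g smooth on ℝ^N \ {0}) and w a toroidal field (x·w = 0, div w = 0, smooth on ℝ^N \ {0}). Then also the full gradients are L²(S^{N-1})-orthogonal: ∫_{S^{N-1}} ∇v · ∇w dσ = 0 for every radius, where ∇v · ∇w = Σ_{j,k} (∂v_j/∂x_k)(∂w_j/∂x_k). -/
open MeasureTheory
open scoped RealInnerProductSpace BigOperators

lemma int_div_zero {N : ℕ} (Φ : EuclideanSpace ℝ (Fin N) → EuclideanSpace ℝ (Fin N))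
    (h : ContDiff ℝ 1 Φ) (hc : HasCompactSupport Φ) :
    ∫ x, ∑ k, fderiv ℝ Φ x (EuclideanSpace.single k 1) k = 0 ∧
      Integrable fun x => ∑ k, fderiv ℝ Φ x (EuclideanSpace.single k 1) k := by
  have hcont : Continuous (fderiv ℝ Φ) := h.continuous_fderiv (by norm_num)
  have hInt : ∀ k : Fin N, Integrable (fun x => fderiv ℝ Φ x (EuclideanSpace.single k 1)) := by
    intro k
    refine Continuous.integrable_of_hasCompactSupport (hcont.clm_apply continuous_const) ?_
    exact (hc.fderiv ℝ).comp_left (g := fun L : EuclideanSpace ℝ (Fin N) →L[ℝ] EuclideanSpace ℝ (Fin N) => L (EuclideanSpace.single k 1)) (by simp)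
  have hz : ∀ k : Fin N, ∫ x, fderiv ℝ Φ x (EuclideanSpace.single k 1) = 0 := by
    intro k
    have := integral_smul_fderiv_eq_neg_fderiv_smul_of_integrable (𝕜 := ℝ)
      (μ := (volume : Measure (EuclideanSpace ℝ (Fin N))))
      (f := fun _ => (1:ℝ)) (g := Φ) (v := EuclideanSpace.single k 1) (by simp)
      (by simpa using hInt k) (by simpa using h.continuous.integrable_of_hasCompactSupport hc)
      (fun x _ => differentiableAt_const _)
      (fun x _ => h.differentiable (by norm_num) x)
    simpa using this
  have hIntK : ∀ k : Fin N, Integrable (fun x => fderiv ℝ Φ x (EuclideanSpace.single k 1) k) :=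
    fun k => (EuclideanSpace.proj k : EuclideanSpace ℝ (Fin N) →L[ℝ] ℝ).integrable_comp (hInt k)
  refine ⟨?_, integrable_finsetSum _ fun k _ => hIntK k⟩
  rw [integral_finsetSum _ fun k _ => hIntK k]
  refine Finset.sum_eq_zero fun k _ => ?_
  have := (EuclideanSpace.proj k : EuclideanSpace ℝ (Fin N) →L[ℝ] ℝ).integral_comp_comm (hInt k)
  simp only [hz k, map_zero] at this
  exact this

lemma radial_zero {E : Type*} [NormedAddCommGroup E] [InnerProductSpace ℝ E] [FiniteDimensional ℝ E]
    [MeasurableSpace E] [BorelSpace E] [Nontrivial E] (F : E → ℝ)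
    (hF : ContinuousOn F {0}ᶜ)
    (h : ∀ γ : ℝ → ℝ, ContDiff ℝ (⊤ : ℕ∞) γ → HasCompactSupport γ → tsupport γ ⊆ Set.Ioi 0 →
      ∫ x, γ ‖x‖ * F x = 0 ∧ Integrable (fun x => γ ‖x‖ * F x)) (r : ℝ) (hr : 0 < r) :
    ∫ σ : Metric.sphere (0 : E) 1, F (r • (σ : E)) ∂(volume.toSphere) = 0 := by
  have : LocallyCompactSpace (Set.Ioi (0:ℝ)) := isOpen_Ioi.locallyCompactSpace
  set d := Module.finrank ℝ E - 1 with hd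
  set I : ℝ → ℝ := fun y => ∫ σ : Metric.sphere (0 : E) 1, F (y • (σ : E)) ∂(volume.toSphere)
  have hI : ContinuousOn I (Set.Ioi 0) := by
    rw [continuousOn_iff_continuous_domRestrict]
    have hc : Continuous (Function.uncurry fun (y : Set.Ioi (0:ℝ)) (σ : Metric.sphere (0 : E) 1) =>
        F ((y : ℝ) • (σ : E))) := by
      have hc0 : Continuous fun p : Set.Ioi (0:ℝ) × Metric.sphere (0 : E) 1 =>
        ((p.1 : ℝ) • (p.2 : E)) := by fun_prop
      refine hF.comp_continuous hc0 ?_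
      rintro ⟨⟨y, hy⟩, σ⟩
      have hs : (σ : E) ≠ 0 := ne_zero_of_mem_unit_sphere σ
      have hy' : y ≠ 0 := ne_of_gt hy
      simp [hs, hy']
    have := continuous_parametric_integral_of_continuous (μ := (volume : Measure E).toSphere)
      hc isCompact_univ
    simp only [Measure.restrict_univ] at this
    exact this
  have hfc : ContinuousOn (fun y : ℝ => y ^ d * I y) (Set.Ioi 0) :=
    (continuous_pow d).continuousOn.mul hI
  have key := isOpen_Ioi.ae_eq_zero_of_integral_contDiff_smul_eq_zero (μ := volume)
    (hfc.locallyIntegrableOn measurableSet_Ioi) (by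
      intro γ hγ hγc hγs
      obtain ⟨h0, hInt⟩ := h γ hγ hγc hγs
      have e1 : ∫ x : E, γ ‖x‖ * F x = ∫ x : ({(0)}ᶜ : Set E), γ ‖x.1‖ * F x ∂(Measure.comap ((↑) : ({(0)}ᶜ : Set E) → E) volume) := by
        rw [integral_subtype_comap (measurableSet_singleton _).compl fun x => γ ‖x‖ * F x,
          restrict_compl_singleton]
      set P : Metric.sphere (0 : E) 1 × Set.Ioi (0:ℝ) → ℝ :=
        fun p => γ p.2 * F ((p.2 : ℝ) • (p.1 : E)) with hP
      have hPeq : ∀ x : ({(0)}ᶜ : Set E), P (homeomorphUnitSphereProd E x) = γ ‖x.1‖ * F x := by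
        intro x
        have hx : ‖(x : E)‖ ≠ 0 := norm_ne_zero_iff.2 x.2
        simp [hP, smul_smul, hx]
      have mp := (volume : Measure E).measurePreserving_homeomorphUnitSphereProd
      have e2 : ∫ x : ({(0)}ᶜ : Set E), γ ‖x.1‖ * F x ∂(Measure.comap ((↑) : ({(0)}ᶜ : Set E) → E) volume)
          = ∫ p, P p ∂((volume : Measure E).toSphere.prod (.volumeIoiPow d)) := by
        rw [← mp.integral_comp (Homeomorph.measurableEmbedding _) P]
        simp only [hPeq]
      have iP : Integrable P ((volume : Measure E).toSphere.prod (.volumeIoiPow d)) := by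
        rw [← mp.integrable_comp_emb (Homeomorph.measurableEmbedding _)]
        have : (P ∘ homeomorphUnitSphereProd E) = (fun x => γ ‖x‖ * F x) ∘ ((↑) : ({(0)}ᶜ : Set E) → E) := by
          funext x; exact hPeq x
        rw [this, ← integrableOn_iff_comap_subtypeVal (measurableSet_singleton _).compl]
        exact hInt.integrableOn
      rw [integral_prod_symm _ iP] at e2
      simp only [hP, integral_const_mul] at e2
      have e3 : ∫ y : Set.Ioi (0:ℝ), γ y * I y ∂(.volumeIoiPow d) = ∫ y in Set.Ioi (0:ℝ), γ y • (y ^ d * I y) := by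
        simp only [Measure.volumeIoiPow, ENNReal.ofReal]
        rw [integral_withDensity_eq_integral_smul (by fun_prop)]
        rw [integral_subtype_comap measurableSet_Ioi fun a ↦ Real.toNNReal (a ^ d) • (γ a * I a)]
        refine setIntegral_congr_fun measurableSet_Ioi fun x hx ↦ ?_
        have : 0 ≤ x ^ d := pow_nonneg (le_of_lt hx) d
        simp only [NNReal.smul_def, Real.coe_toNNReal _ this, smul_eq_mul]
        ring
      rw [← setIntegral_eq_integral_of_forall_compl_eq_zero (s := Set.Ioi (0:ℝ)), ← e3, ← e2, ← e1, h0]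
      intro x hx
      have : γ x = 0 := by
        by_contra hne
        exact hx (hγs (subset_tsupport _ hne))
      simp [this])
  have := Measure.eqOn_open_of_ae_eq (μ := (volume : Measure ℝ)) (U := Set.Ioi (0:ℝ))
    (f := fun y : ℝ => y ^ d * I y) (g := fun _ => 0)
    ((ae_restrict_iff' measurableSet_Ioi).2 key) isOpen_Ioi hfc continuousOn_const
  have h1 := this hr
  simpa [hr.ne'] using h1

lemma hasFDerivAt_radial {E : Type*} [NormedAddCommGroup E] [InnerProductSpace ℝ E]
    (φ : ℝ → ℝ) (x : E) (hx : x ≠ 0) (hφ : DifferentiableAt ℝ φ ‖x‖) :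
    HasFDerivAt (fun y => φ ‖y‖) ((deriv φ ‖x‖ / ‖x‖) • innerSL ℝ x) x := by
  have hx' : ‖x‖ ≠ 0 := norm_ne_zero_iff.2 hx
  have h1 : HasFDerivAt (fun y : E => ‖y‖) ((1 / ‖x‖) • innerSL ℝ x) x := by
    have := (hasStrictFDerivAt_norm_sq x).hasFDerivAt.sqrt (by positivity)
    simp only [Real.sqrt_sq (norm_nonneg _)] at this
    convert this using 1
    ext y
    simp
    field_simp
  have h2 := hφ.hasDerivAt.comp_hasFDerivAt x h1
  rw [smul_smul, mul_one_div] at h2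
  exact h2

lemma alg_div {N : ℕ} (x p w0 : EuclideanSpace ℝ (Fin N))
    (A B : EuclideanSpace ℝ (Fin N) →L[ℝ] EuclideanSpace ℝ (Fin N))
    (A₂ : EuclideanSpace ℝ (Fin N) →L[ℝ] EuclideanSpace ℝ (Fin N) →L[ℝ] EuclideanSpace ℝ (Fin N))
    (G : EuclideanSpace ℝ (Fin N) →L[ℝ] ℝ) (H c c' g0 f0 : ℝ)
    (hB : ∀ a b, ⟪B a, b⟫ = ⟪B b, a⟫)
    (hA₂ : ∑ k, A₂ (EuclideanSpace.single k 1) p k = 0)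
    (hA : ∑ k, A (EuclideanSpace.single k 1) k = 0)
    (hxw : ⟪x, w0⟫ = 0) (hxA : ∀ e, ⟪x, A e⟫ = -⟪e, w0⟫) :
    ∑ k, (H • (A₂ (EuclideanSpace.single k 1) p + A (B (EuclideanSpace.single k 1))
        - (g0 • A (EuclideanSpace.single k 1) + G (EuclideanSpace.single k 1) • w0))
      + (c * ⟪x, EuclideanSpace.single k 1⟫) • (A p - g0 • w0)
      + (c • (f0 • A (EuclideanSpace.single k 1) + ⟪p, EuclideanSpace.single k 1⟫ • w0)
        + (c' * ⟪x, EuclideanSpace.single k 1⟫) • (f0 • w0))) k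
    = H * ∑ k, ⟪g0 • EuclideanSpace.single k 1 + G (EuclideanSpace.single k 1) • x
        + B (EuclideanSpace.single k 1), A (EuclideanSpace.single k 1)⟫ := by
  have t2 : ∑ k, A (B (EuclideanSpace.single k 1)) k =
      ∑ k, ⟪B (EuclideanSpace.single k 1), A (EuclideanSpace.single k 1)⟫ := by
    have hexp : ∀ z : EuclideanSpace ℝ (Fin N), z = ∑ j, z j • EuclideanSpace.single j (1:ℝ) := by
      intro z
      ext i
      simp [Finset.sum_apply, Pi.single_apply]
    have hl : ∀ k, A (B (EuclideanSpace.single k 1)) k = ∑ j,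
        B (EuclideanSpace.single k 1) j * A (EuclideanSpace.single j 1) k := by
      intro k
      conv_lhs => rw [hexp (B (EuclideanSpace.single k 1))]
      simp [map_sum]
    have hs : ∀ j k, B (EuclideanSpace.single k 1) j = B (EuclideanSpace.single j 1) k := by
      intro j k
      have := hB (EuclideanSpace.single k 1) (EuclideanSpace.single j 1)
      simpa [EuclideanSpace.inner_single_right] using this
    simp only [hl]
    rw [Finset.sum_comm]
    refine Finset.sum_congr rfl fun j _ => ?_
    rw [PiLp.inner_apply]
    refine Finset.sum_congr rfl fun k _ => ?_
    rw [hs j k]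
    simp [mul_comm]
  have hin : ∀ a b : EuclideanSpace ℝ (Fin N), ∑ k, a k * b k = ⟪a, b⟫ := by
    intro a b
    simp [PiLp.inner_apply, mul_comm]
  have i1 : ∑ k, x k * A p k = - ⟪p, w0⟫ := by rw [hin, hxA]
  have i2 : ∑ k, x k * w0 k = 0 := by rw [hin, hxw]
  have i3 : ∑ k, p k * w0 k = ⟪p, w0⟫ := hin p w0
  have hr : ∀ k, ⟪g0 • EuclideanSpace.single k 1 + G (EuclideanSpace.single k 1) • x
        + B (EuclideanSpace.single k 1), A (EuclideanSpace.single k 1)⟫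
      = g0 * A (EuclideanSpace.single k 1) k - G (EuclideanSpace.single k 1) * w0 k
        + ⟪B (EuclideanSpace.single k 1), A (EuclideanSpace.single k 1)⟫ := by
    intro k
    rw [inner_add_left, inner_add_left, inner_smul_left, inner_smul_left, hxA]
    simp [EuclideanSpace.inner_single_left]
    ring
  simp only [hr]
  have hl : ∀ k, (H • (A₂ (EuclideanSpace.single k 1) p + A (B (EuclideanSpace.single k 1))
        - (g0 • A (EuclideanSpace.single k 1) + G (EuclideanSpace.single k 1) • w0))
      + (c * ⟪x, EuclideanSpace.single k 1⟫) • (A p - g0 • w0)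
      + (c • (f0 • A (EuclideanSpace.single k 1) + ⟪p, EuclideanSpace.single k 1⟫ • w0)
        + (c' * ⟪x, EuclideanSpace.single k 1⟫) • (f0 • w0))) k
      = H * A₂ (EuclideanSpace.single k 1) p k + H * A (B (EuclideanSpace.single k 1)) k
        - H * (g0 * A (EuclideanSpace.single k 1) k)
        - H * (G (EuclideanSpace.single k 1) * w0 k)
        + c * (x k * A p k) - c * g0 * (x k * w0 k) + c * f0 * A (EuclideanSpace.single k 1) k
        + c * (p k * w0 k) + c' * f0 * (x k * w0 k) := by
    intro k
    simp [EuclideanSpace.inner_single_right]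
    ring
  simp only [hl, Finset.sum_add_distrib, Finset.sum_sub_distrib, ← Finset.mul_sum, hA₂, hA, t2, i1, i2, i3]
  ring

/-- the gradients of a pre-poloidal field and of a toroidal field
are `L²(S^{N-1})`-orthogonal (Frobenius inner product) at every radius. -/
theorem stmt9 (N : ℕ) (hN : 3 ≤ N)
    (f g : EuclideanSpace ℝ (Fin N) → ℝ)
    (hf : ContDiffOn ℝ (⊤ : ℕ∞) f {(0 : EuclideanSpace ℝ (Fin N))}ᶜ)
    (hg : ContDiffOn ℝ (⊤ : ℕ∞) g {(0 : EuclideanSpace ℝ (Fin N))}ᶜ)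
    (v : EuclideanSpace ℝ (Fin N) → EuclideanSpace ℝ (Fin N))
    (hvsm : ContDiffOn ℝ (⊤ : ℕ∞) v {(0 : EuclideanSpace ℝ (Fin N))}ᶜ)
    (hv : ∀ x : EuclideanSpace ℝ (Fin N), x ≠ 0 → v x = g x • x + gradient f x)
    (w : EuclideanSpace ℝ (Fin N) → EuclideanSpace ℝ (Fin N))
    (hw : ContDiffOn ℝ (⊤ : ℕ∞) w {(0 : EuclideanSpace ℝ (Fin N))}ᶜ)
    (hwsph : ∀ x : EuclideanSpace ℝ (Fin N), x ≠ 0 → ⟪x, w x⟫ = 0)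
    (hwdiv : ∀ x : EuclideanSpace ℝ (Fin N), x ≠ 0 →
      ∑ k, fderiv ℝ w x (EuclideanSpace.single k 1) k = 0) :
    ∀ r : ℝ, 0 < r →
      (∫ σ : Metric.sphere (0 : EuclideanSpace ℝ (Fin N)) 1,
          ∑ k, ⟪fderiv ℝ v (r • (σ : EuclideanSpace ℝ (Fin N)))
                  (EuclideanSpace.single k 1),
                fderiv ℝ w (r • (σ : EuclideanSpace ℝ (Fin N)))
                  (EuclideanSpace.single k 1)⟫ ∂(volume.toSphere))
        = 0 := by
  have : Nontrivial (Fin N) := Fin.nontrivial_iff_two_le.2 (by omega)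
  have hop : IsOpen ({(0 : EuclideanSpace ℝ (Fin N))}ᶜ) := isOpen_compl_singleton
  have hfA : ∀ x, x ≠ 0 → ContDiffAt ℝ (⊤ : ℕ∞) f x := fun x hx => hf.contDiffAt (hop.mem_nhds hx)
  have hgA : ∀ x, x ≠ 0 → ContDiffAt ℝ (⊤ : ℕ∞) g x := fun x hx => hg.contDiffAt (hop.mem_nhds hx)
  have hvA : ∀ x, x ≠ 0 → ContDiffAt ℝ (⊤ : ℕ∞) v x := fun x hx => hvsm.contDiffAt (hop.mem_nhds hx)
  have hwA : ∀ x, x ≠ 0 → ContDiffAt ℝ (⊤ : ℕ∞) w x := fun x hx => hw.contDiffAt (hop.mem_nhds hx)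
  have hdf : ∀ x, x ≠ 0 → ContDiffAt ℝ (⊤ : ℕ∞) (fderiv ℝ f) x :=
    fun x hx => (hfA x hx).fderiv_right (by simp)
  have hdv : ∀ x, x ≠ 0 → ContDiffAt ℝ (⊤ : ℕ∞) (fderiv ℝ v) x :=
    fun x hx => (hvA x hx).fderiv_right (by simp)
  have hdw : ∀ x, x ≠ 0 → ContDiffAt ℝ (⊤ : ℕ∞) (fderiv ℝ w) x :=
    fun x hx => (hwA x hx).fderiv_right (by simp)
  have hp : ∀ x, x ≠ 0 → ContDiffAt ℝ (⊤ : ℕ∞) (gradient f) x := fun x hx =>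
    ((InnerProductSpace.toDual ℝ (EuclideanSpace ℝ (Fin N))).symm.contDiff.contDiffAt).comp x (hdf x hx)
  refine radial_zero (fun x => ∑ k, ⟪fderiv ℝ v x (EuclideanSpace.single k 1),
                fderiv ℝ w x (EuclideanSpace.single k 1)⟫) ?_ ?_
  · refine continuousOn_finsetSum _ fun k _ => ?_
    refine fun x hx => ContinuousAt.continuousWithinAt ?_
    exact ((hdv x hx).continuousAt.clm_apply continuousAt_const).inner
      ((hdw x hx).continuousAt.clm_apply continuousAt_const)
  intro γ hγ hγc hγs
  have hdγ : ContDiff ℝ (⊤ : ℕ∞) (deriv γ) := (contDiff_infty_iff_deriv.1 hγ).2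
  set K : ℝ → ℝ := fun s => deriv γ s / s with hK
  have hKA : ∀ s, s ≠ 0 → ContDiffAt ℝ (⊤ : ℕ∞) K s := fun s hs =>
    hdγ.contDiffAt.div contDiffAt_id hs
  set Φ : EuclideanSpace ℝ (Fin N) → EuclideanSpace ℝ (Fin N) := fun x =>
    γ ‖x‖ • (fderiv ℝ w x (gradient f x) - g x • w x) + K ‖x‖ • (f x • w x) with hΦ
  have h0 : (0:ℝ) ∉ tsupport γ := fun h => lt_irrefl (0:ℝ) (Set.mem_Ioi.1 (hγs h))
  have hγ0 : γ =ᶠ[nhds 0] 0 := notMem_tsupport_iff_eventuallyEq.1 h0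
  have hΦ0 : Φ =ᶠ[nhds 0] 0 := by
    have hd0 : deriv γ =ᶠ[nhds 0] deriv 0 := hγ0.deriv
    have ht : Filter.Tendsto (fun x : EuclideanSpace ℝ (Fin N) => ‖x‖) (nhds 0) (nhds 0) := by
      simpa using (continuous_norm (E := EuclideanSpace ℝ (Fin N))).tendsto 0
    filter_upwards [ht.eventually hγ0, ht.eventually hd0] with x h1 h2
    have h2' : deriv γ ‖x‖ = 0 := by rw [h2]; simp
    simp [hΦ, hK, h1, h2']
  have hΦs : ContDiff ℝ 1 Φ := by
    rw [contDiff_iff_contDiffAt]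
    intro x
    by_cases hx : x = 0
    · subst hx
      exact (contDiffAt_const (c := 0)).congr_of_eventuallyEq hΦ0
    · have hn : ‖x‖ ≠ 0 := norm_ne_zero_iff.2 hx
      have hnA : ContDiffAt ℝ (⊤ : ℕ∞) (fun y : EuclideanSpace ℝ (Fin N) => ‖y‖) x :=
        contDiffAt_norm ℝ hx
      have : ContDiffAt ℝ (⊤ : ℕ∞) Φ x := by
        refine ((hγ.contDiffAt.comp x hnA).smul (((hdw x hx).clm_apply (hp x hx)).sub
          ((hgA x hx).smul (hwA x hx)))).add
          (((hKA _ hn).comp x hnA).smul ((hfA x hx).smul (hwA x hx)))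
      exact this.of_le (by exact_mod_cast le_top)
  have hΦc : HasCompactSupport Φ := by
    obtain ⟨R, hR⟩ := hγc.isCompact.isBounded.subset_closedBall (0:ℝ)
    refine HasCompactSupport.intro (isCompact_closedBall (0 : EuclideanSpace ℝ (Fin N)) R) ?_
    intro x hx
    have hx' : ‖x‖ ∉ tsupport γ := fun h => hx (by simpa using hR h)
    have h1 : γ ‖x‖ = 0 := image_eq_zero_of_notMem_tsupport hx'
    have h2 : deriv γ ‖x‖ = 0 := by
      by_contra hne
      exact hx' (support_deriv_subset hne)
    simp [hΦ, hK, h1, h2]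
  have hmain : ∀ x, ∑ k, fderiv ℝ Φ x (EuclideanSpace.single k 1) k =
      γ ‖x‖ * ∑ k, ⟪fderiv ℝ v x (EuclideanSpace.single k 1),
                fderiv ℝ w x (EuclideanSpace.single k 1)⟫ := by
    intro x
    by_cases hx : x = 0
    · subst hx
      have h1 : γ 0 = 0 := image_eq_zero_of_notMem_tsupport h0
      rw [hΦ0.fderiv_eq]
      simp [h1]
    have hn : ‖x‖ ≠ 0 := norm_ne_zero_iff.2 hx
    have hnx : ∀ᶠ y in nhds x, y ≠ 0 := hop.mem_nhds hx
    have dw := ((hwA x hx).differentiableAt (by simp)).hasFDerivAt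
    have ddw := ((hdw x hx).differentiableAt (by simp)).hasFDerivAt
    have ddf := ((hdf x hx).differentiableAt (by simp)).hasFDerivAt
    have dg := ((hgA x hx).differentiableAt (by simp)).hasFDerivAt
    have dp := ((hp x hx).differentiableAt (by simp)).hasFDerivAt
    have df : HasFDerivAt f (innerSL ℝ (gradient f x)) x :=
      ((hfA x hx).differentiableAt (by simp)).hasGradientAt.hasFDerivAt
    have dH := hasFDerivAt_radial γ x hx (hγ.differentiable (by simp) _)
    have dK := hasFDerivAt_radial K x hx ((hKA _ hn).differentiableAt (by simp))
    have dΦ := (dH.smul ((ddw.clm_apply dp).sub (dg.smul dw))).add (dK.smul (df.smul dw))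
    have dv : HasFDerivAt v _ x := ((dg.smul (hasFDerivAt_id x)).add dp).congr_of_eventuallyEq
      (hnx.mono fun y hy => hv y hy)
    have hB : ∀ a b, ⟪fderiv ℝ (gradient f) x a, b⟫ = ⟪fderiv ℝ (gradient f) x b, a⟫ := by
      have e : ∀ a b, ⟪fderiv ℝ (gradient f) x a, b⟫ = fderiv ℝ (fderiv ℝ f) x a b := by
        intro a b
        have h2 : HasFDerivAt (gradient f) _ x :=
          (((InnerProductSpace.toDual ℝ (EuclideanSpace ℝ (Fin N))).symm.toContinuousLinearEquiv).hasFDerivAt).comp x ddf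
        rw [h2.fderiv]
        simp
      intro a b
      rw [e, e]
      exact ((hfA x hx).isSymmSndFDerivAt (by simp only [minSmoothness_of_isRCLikeNormedField]; exact WithTop.coe_le_coe.2 (le_top : (2 : ℕ∞) ≤ ⊤))) a b
    have hxA : ∀ e, ⟪x, fderiv ℝ w x e⟫ = -⟪e, w x⟫ := by
      intro e
      have h1 := (hasFDerivAt_id (𝕜 := ℝ) x).inner ℝ dw
      have h2 : HasFDerivAt (fun y => ⟪id y, w y⟫) (0 : EuclideanSpace ℝ (Fin N) →L[ℝ] ℝ) x :=
        (hasFDerivAt_const (0:ℝ) x).congr_of_eventuallyEq (hnx.mono fun y hy => hwsph y hy)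
      have h3 := congrArg (fun L => L e) (h1.unique h2)
      simp at h3
      linarith
    have hA₂ : ∑ k, fderiv ℝ (fderiv ℝ w) x (EuclideanSpace.single k 1) (gradient f x) k = 0 := by
      have hsy : ∀ a b, fderiv ℝ (fderiv ℝ w) x a b = fderiv ℝ (fderiv ℝ w) x b a :=
        fun a b => ((hwA x hx).isSymmSndFDerivAt (by simp only [minSmoothness_of_isRCLikeNormedField]; exact WithTop.coe_le_coe.2 (le_top : (2 : ℕ∞) ≤ ⊤))) a b
      have h1 : HasFDerivAt (fun y => ∑ k, fderiv ℝ w y (EuclideanSpace.single k 1) k) _ x :=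
        HasFDerivAt.fun_sum (u := Finset.univ) fun k _ =>
          ((EuclideanSpace.proj k : EuclideanSpace ℝ (Fin N) →L[ℝ] ℝ).hasFDerivAt).comp x
          (ddw.clm_apply (hasFDerivAt_const (EuclideanSpace.single k (1:ℝ)) x))
      have h2 : HasFDerivAt (fun y => ∑ k, fderiv ℝ w y (EuclideanSpace.single k 1) k)
          (0 : EuclideanSpace ℝ (Fin N) →L[ℝ] ℝ) x :=
        (hasFDerivAt_const (0:ℝ) x).congr_of_eventuallyEq (hnx.mono fun y hy => hwdiv y hy)
      have h3 := congrArg (fun L => L (gradient f x)) (h1.unique h2)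
      simp only [hsy _ (gradient f x)]
      simpa using h3
    have := alg_div x (gradient f x) (w x) (fderiv ℝ w x) (fderiv ℝ (gradient f) x)
      (fderiv ℝ (fderiv ℝ w) x) (fderiv ℝ g x) (γ ‖x‖) (K ‖x‖) (deriv K ‖x‖ / ‖x‖) (g x) (f x)
      hB hA₂ (hwdiv x hx) (hwsph x hx) hxA
    rw [dv.fderiv, show fderiv ℝ Φ x = _ from dΦ.fderiv]
    convert this using 1
    · refine Finset.sum_congr rfl fun k _ => ?_
      simp [hK]
      ring_nf
      simp
    · rfl
  obtain ⟨r1, r2⟩ := int_div_zero Φ hΦs hΦc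
  simp only [hmain] at r1 r2
  exact ⟨r1, r2⟩
end

section
/- Let N ≥ 3 and γ ∈ ℝ. For every smooth compactly supported toroidal field u on ℝ^N \ {0} (i.e., x·u = 0 and div u = 0), the Hardy–Leray inequality ∫_{ℝ^N} |∇u|² |x|^{2γ} dx ≥ ((γ + (N-2)/2)² + N - 1) ∫_{ℝ^N} |u|²|x|^{2γ-2} dx holds, with remainder: the left side minus the right side is at least ∫_{ℝ^N} |x·∇(|x|^{γ+(N-2)/2}u)|² |x|^{-N} dx. -/
open MeasureTheory
open scoped RealInnerProductSpace BigOperators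

theorem alg_aux (n : ℕ) (a : Fin n → Fin n → ℝ) (x u w : Fin n → ℝ) (R : ℝ) (hR0 : 0 < R)
    (hR : ∑ j, x j * x j = R) (h1 : ∀ k, ∑ j, x j * a j k = - u k)
    (h2 : ∀ j, ∑ k, a j k * x k = w j) (h3 : ∑ j, x j * u j = 0) :
    0 ≤ R * (∑ k, ∑ j, a j k ^ 2) - (∑ j, w j ^ 2) - (∑ j, u j ^ 2)
      + R * (∑ k, ∑ j, a j k * a k j) + 2 * (∑ j, u j * w j) := by
  have hxw : ∑ j, x j * w j = 0 := by
    simp_rw [← h2, Finset.mul_sum]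
    rw [Finset.sum_comm]
    have : ∀ k, ∑ j, x j * (a j k * x k) = - (x k * u k) := by
      intro k
      have := h1 k
      calc ∑ j, x j * (a j k * x k) = (∑ j, x j * a j k) * x k := by
            rw [Finset.sum_mul]; exact Finset.sum_congr rfl fun _ _ => by ring
        _ = _ := by rw [this]; ring
    simp_rw [this]
    rw [Finset.sum_neg_distrib, h3, neg_zero]
  have key : ∀ (p q : Fin n → ℝ), ∑ k, ∑ j, p j * q k = (∑ j, p j) * ∑ k, q k := by
    intro p q
    rw [Finset.sum_comm, Finset.sum_mul_sum]
  let b : Fin n → Fin n → ℝ := fun j k => R * a j k - w j * x k + x j * u k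
  have hb1 : ∑ k, ∑ j, b j k ^ 2 = R * (R * (∑ k, ∑ j, a j k ^ 2) - (∑ j, w j ^ 2) - (∑ j, u j ^ 2)) := by
    have e1 : ∑ k, ∑ j, a j k * (w j * x k) = ∑ j, w j ^ 2 := by
      rw [Finset.sum_comm]
      refine Finset.sum_congr rfl fun j _ => ?_
      rw [sq]; nth_rw 3 [← h2 j]; rw [Finset.mul_sum]
      exact Finset.sum_congr rfl fun _ _ => by ring
    have e2 : ∑ k, ∑ j, a j k * (x j * u k) = - ∑ j, u j ^ 2 := by
      rw [← Finset.sum_neg_distrib]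
      refine Finset.sum_congr rfl fun k _ => ?_
      calc ∑ j, a j k * (x j * u k) = (∑ j, x j * a j k) * u k := by
            rw [Finset.sum_mul]; exact Finset.sum_congr rfl fun _ _ => by ring
        _ = _ := by rw [h1]; ring
    have e3 := key (fun j => w j ^ 2) (fun k => x k * x k)
    have e4 := key (fun j => x j * x j) (fun k => u k ^ 2)
    have e5 := key (fun j => x j * w j) (fun k => x k * u k)
    simp only [hR, hxw] at e3 e4 e5
    calc ∑ k, ∑ j, b j k ^ 2 = ∑ k, ∑ j, (R^2 * a j k ^ 2 + w j ^2 * (x k * x k) + x j * x j * u k ^2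
          - 2 * R * (a j k * (w j * x k)) + 2 * R * (a j k * (x j * u k)) - 2 * (x j * w j * (x k * u k))) :=
          Finset.sum_congr rfl fun _ _ => Finset.sum_congr rfl fun _ _ => by simp only [b]; ring
      _ = _ := by
        simp only [Finset.sum_add_distrib, Finset.sum_sub_distrib, ← Finset.mul_sum, e1, e2, e5, e3, e4]
        ring
  have hb2 : ∑ k, ∑ j, b j k * b k j = R * (R * (∑ k, ∑ j, a j k * a k j) + 2 * (∑ j, u j * w j)) := by
    have e1 : ∑ k, ∑ j, a j k * (w k * x j) = - ∑ j, u j * w j := by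
      rw [← Finset.sum_neg_distrib]
      refine Finset.sum_congr rfl fun k _ => ?_
      calc ∑ j, a j k * (w k * x j) = (∑ j, x j * a j k) * w k := by
            rw [Finset.sum_mul]; exact Finset.sum_congr rfl fun _ _ => by ring
        _ = _ := by rw [h1]; ring
    have e1' : ∑ k, ∑ j, a k j * (w j * x k) = - ∑ j, u j * w j := by
      rw [Finset.sum_comm]; exact e1
    have e2 : ∑ k, ∑ j, a j k * (x k * u j) = ∑ j, u j * w j := by
      rw [Finset.sum_comm]
      refine Finset.sum_congr rfl fun j _ => ?_
      rw [← h2 j, Finset.mul_sum]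
      exact Finset.sum_congr rfl fun _ _ => by ring
    have e2' : ∑ k, ∑ j, a k j * (x j * u k) = ∑ j, u j * w j := by
      rw [Finset.sum_comm]; exact e2
    have e3 := key (fun j => x j * w j) (fun k => x k * w k)
    have e4 := key (fun j => x j * u j) (fun k => x k * u k)
    have e5 := key (fun j => u j * w j) (fun k => x k * x k)
    have e6 := key (fun j => x j * x j) (fun k => u k * w k)
    simp only [hR, hxw, h3] at e3 e4 e5 e6
    calc ∑ k, ∑ j, b j k * b k j = ∑ k, ∑ j, (R^2 * (a j k * a k j) + x j * w j * (x k * w k)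
          + x j * u j * (x k * u k) - R * (a j k * (w k * x j)) - R * (a k j * (w j * x k))
          + R * (a j k * (x k * u j)) + R * (a k j * (x j * u k))
          - u j * w j * (x k * x k) - x j * x j * (u k * w k)) :=
          Finset.sum_congr rfl fun _ _ => Finset.sum_congr rfl fun _ _ => by simp only [b]; ring
      _ = _ := by
        simp only [Finset.sum_add_distrib, Finset.sum_sub_distrib, ← Finset.mul_sum, e1, e2, e1', e2', e5, e3, e4, e6]
        ring
  have hsum : 0 ≤ ∑ k, ∑ j, (b j k + b k j) ^ 2 :=
    Finset.sum_nonneg fun _ _ => Finset.sum_nonneg fun _ _ => sq_nonneg _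
  have hexp : ∑ k, ∑ j, (b j k + b k j) ^ 2 = 2 * (∑ k, ∑ j, b j k ^ 2) + 2 * ∑ k, ∑ j, b j k * b k j := by
    have : ∑ k, ∑ j, b k j ^ 2 = ∑ k, ∑ j, b j k ^ 2 := Finset.sum_comm
    rw [show 2 * (∑ k, ∑ j, b j k ^ 2) = (∑ k, ∑ j, b j k ^ 2) + ∑ k, ∑ j, b k j ^ 2 by rw [this]; ring,
      Finset.mul_sum, ← Finset.sum_add_distrib, ← Finset.sum_add_distrib]
    refine Finset.sum_congr rfl fun k _ => ?_
    rw [Finset.mul_sum, ← Finset.sum_add_distrib, ← Finset.sum_add_distrib]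
    exact Finset.sum_congr rfl fun _ _ => by ring
  rw [hexp, hb1, hb2] at hsum
  have : 0 ≤ R * (R * (∑ k, ∑ j, a j k ^ 2) - (∑ j, w j ^ 2) - (∑ j, u j ^ 2)
      + R * (∑ k, ∑ j, a j k * a k j) + 2 * (∑ j, u j * w j)) := by linarith
  exact nonneg_of_mul_nonneg_right this hR0

theorem hasFDerivAt_weight {E : Type*} [NormedAddCommGroup E] [InnerProductSpace ℝ E]
    (a : ℝ) (x : E) (hx : x ≠ 0) :
    HasFDerivAt (fun y : E => ‖y‖ ^ a) ((a * ‖x‖ ^ (a - 2)) • innerSL ℝ x) x := by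
  have hpos : 0 < ‖x‖ := norm_pos_iff.2 hx
  have h := (hasStrictFDerivAt_norm_sq x).hasFDerivAt.rpow_const (p := a / 2)
    (Or.inl (by positivity))
  have e1 : ∀ y : E, (‖y‖ ^ 2) ^ (a / 2) = ‖y‖ ^ a := by
    intro y
    rw [← Real.rpow_natCast, ← Real.rpow_mul (norm_nonneg _)]
    congr 1; push_cast; ring
  simp only [e1] at h
  convert h using 1
  rw [← Real.rpow_natCast, ← Real.rpow_mul (norm_nonneg _), ← Nat.cast_smul_eq_nsmul ℝ, smul_smul]
  congr 1
  push_cast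
  rw [show (2 : ℝ) * (a / 2 - 1) = a - 2 by ring]
  ring

theorem integrable_weight {E : Type*} [NormedAddCommGroup E] [MeasurableSpace E] [BorelSpace E]
    (μ : Measure E) [IsFiniteMeasureOnCompacts μ] (K : Set E) (hK : IsCompact K) (h0 : (0 : E) ∉ K)
    (g : E → ℝ) (hg : Continuous g) (hgK : ∀ x, x ∉ K → g x = 0) (a : ℝ) :
    Integrable (fun x => g x * ‖x‖ ^ a) μ := by
  have hs : Function.support (fun x => g x * ‖x‖ ^ a) ⊆ K := by
    intro x hx
    by_contra h
    exact hx (by simp [hgK x h])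
  rw [← integrableOn_iff_integrable_of_support_subset hs]
  refine ContinuousOn.integrableOn_compact hK ?_
  refine hg.continuousOn.mul ?_
  refine ContinuousOn.rpow_const continuous_norm.continuousOn ?_
  intro x hx
  left
  rw [norm_ne_zero_iff]
  rintro rfl
  exact h0 hx

theorem fderiv_zero_outside {E F : Type*} [NormedAddCommGroup E] [NormedSpace ℝ E]
    [NormedAddCommGroup F] [NormedSpace ℝ F]
    (K : Set E) (hK : IsClosed K) (g : E → F) (hgK : ∀ x, x ∉ K → g x = 0) (x : E) (hx : x ∉ K) :
    fderiv ℝ g x = 0 := by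
  have : g =ᶠ[nhds x] fun _ => 0 := by
    filter_upwards [hK.isOpen_compl.mem_nhds hx] with y hy using hgK y hy
  rw [this.fderiv_eq]; simp

theorem ibp_weight {E : Type*} [NormedAddCommGroup E] [InnerProductSpace ℝ E]
    [FiniteDimensional ℝ E] [MeasurableSpace E] [BorelSpace E]
    (μ : Measure E) [μ.IsAddHaarMeasure] (K : Set E) (hK : IsCompact K) (h0 : (0 : E) ∉ K)
    (g : E → ℝ) (hg : ContDiff ℝ 1 g) (hgK : ∀ x, x ∉ K → g x = 0) (a : ℝ) (e : E) :
    Integrable (fun x => fderiv ℝ g x e * ‖x‖ ^ a + a * (⟪x, e⟫ * g x) * ‖x‖ ^ (a - 2)) μ ∧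
    ∫ x, (fderiv ℝ g x e * ‖x‖ ^ a + a * (⟪x, e⟫ * g x) * ‖x‖ ^ (a - 2)) ∂μ = 0 := by
  have hd0 := fderiv_zero_outside K hK.isClosed g hgK
  have hts : tsupport g ⊆ K := by
    refine closure_minimal ?_ hK.isClosed
    intro x hx
    by_contra h
    exact hx (hgK x h)
  have hne : ∀ x ∈ K, x ≠ 0 := by
    rintro x hx rfl; exact h0 hx
  have i1 : Integrable (fun x => fderiv ℝ g x e * ‖x‖ ^ a) μ := by
    refine integrable_weight μ K hK h0 _ ?_ ?_ a
    · exact (hg.continuous_fderiv one_ne_zero).clm_apply continuous_const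
    · intro x hx; simp [hd0 x hx]
  have i2 : Integrable (fun x => a * (⟪x, e⟫ * g x) * ‖x‖ ^ (a - 2)) μ := by
    refine integrable_weight μ K hK h0 _ ?_ ?_ _
    · have := hg.continuous; fun_prop
    · intro x hx; simp [hgK x hx]
  have i3 : Integrable (fun x => g x * ‖x‖ ^ a) μ :=
    integrable_weight μ K hK h0 _ hg.continuous hgK a
  have hw : ∀ x, fderiv ℝ (fun y : E => ‖y‖ ^ a) x e * g x
      = a * (⟪x, e⟫ * g x) * ‖x‖ ^ (a - 2) := by
    intro x
    by_cases hx : x ∈ K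
    · rw [(hasFDerivAt_weight a x (hne x hx)).fderiv]
      simp; ring
    · simp [hgK x hx]
  refine ⟨i1.add i2, ?_⟩
  have h := integral_mul_fderiv_eq_neg_fderiv_mul_of_integrable (μ := μ)
    (f := fun y : E => ‖y‖ ^ a) (g := g) (v := e) (by simpa only [hw] using i2)
    (by simpa only [mul_comm] using i1) (by simpa only [mul_comm] using i3)
    (fun x hx => (hasFDerivAt_weight a x (hne x (hts hx))).differentiableAt)
    (fun x _ => hg.differentiable one_ne_zero x)
  rw [integral_add i1 i2]
  simp only [hw] at h
  rw [← sub_eq_zero, sub_neg_eq_add] at h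
  simpa only [mul_comm (‖_‖ ^ a)] using h

theorem fderiv_coord {N : ℕ} {E : Type*} [NormedAddCommGroup E] [NormedSpace ℝ E]
    (F : E → EuclideanSpace ℝ (Fin N)) (x e : E) (hF : DifferentiableAt ℝ F x) (k : Fin N) :
    fderiv ℝ (fun y => F y k) x e = fderiv ℝ F x e k := by
  have h := ((EuclideanSpace.proj k : EuclideanSpace ℝ (Fin N) →L[ℝ] ℝ).hasFDerivAt.comp x
    hF.hasFDerivAt).fderiv
  have h2 : fderiv ℝ (fun y => F y k) x =
    (EuclideanSpace.proj k : EuclideanSpace ℝ (Fin N) →L[ℝ] ℝ).comp (fderiv ℝ F x) := h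
  rw [h2]; rfl

/-- Divergence theorem with weight. -/
theorem div_weight {N : ℕ} (K : Set (EuclideanSpace ℝ (Fin N))) (hK : IsCompact K)
    (h0 : (0 : EuclideanSpace ℝ (Fin N)) ∉ K)
    (F : EuclideanSpace ℝ (Fin N) → EuclideanSpace ℝ (Fin N)) (hF : ContDiff ℝ 1 F)
    (hFK : ∀ x, x ∉ K → F x = 0) (a : ℝ) :
    Integrable (fun x => (∑ k, fderiv ℝ F x (EuclideanSpace.single k 1) k) * ‖x‖ ^ a
      + a * ⟪x, F x⟫ * ‖x‖ ^ (a - 2)) ∧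
    ∫ x, ((∑ k, fderiv ℝ F x (EuclideanSpace.single k 1) k) * ‖x‖ ^ a
      + a * ⟪x, F x⟫ * ‖x‖ ^ (a - 2)) = 0 := by
  have h := fun k : Fin N => ibp_weight volume K hK h0 (fun x => F x k)
    ((EuclideanSpace.proj k : EuclideanSpace ℝ (Fin N) →L[ℝ] ℝ).contDiff.comp hF)
    (fun x hx => by simp [hFK x hx]) a (EuclideanSpace.single k 1)
  have he : ∀ x, (∑ k, fderiv ℝ F x (EuclideanSpace.single k 1) k) * ‖x‖ ^ a
      + a * ⟪x, F x⟫ * ‖x‖ ^ (a - 2) = ∑ k, (fderiv ℝ (fun x => F x k) x (EuclideanSpace.single k 1)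
        * ‖x‖ ^ a + a * (⟪x, EuclideanSpace.single k (1:ℝ)⟫ * F x k) * ‖x‖ ^ (a - 2)) := by
    intro x
    rw [Finset.sum_add_distrib, ← Finset.sum_mul, ← Finset.sum_mul, ← Finset.mul_sum]
    congr 2
    · exact Finset.sum_congr rfl fun k _ => (fderiv_coord F x _ (hF.differentiable one_ne_zero x) k).symm
    · congr 1
      rw [PiLp.inner_apply]
      refine Finset.sum_congr rfl fun k _ => ?_
      simp [EuclideanSpace.inner_single_right]
      ring
  simp only [he]
  refine ⟨integrable_finsetSum _ fun k _ => (h k).1, ?_⟩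
  rw [integral_finsetSum _ fun k _ => (h k).1]
  exact Finset.sum_eq_zero fun k _ => (h k).2

theorem sum_single_smul {N : ℕ} (x : EuclideanSpace ℝ (Fin N)) :
    ∑ k, x k • EuclideanSpace.single k (1 : ℝ) = x := by
  ext i
  simp [Pi.single_apply]

theorem D1 {N : ℕ} (K : Set (EuclideanSpace ℝ (Fin N))) (hK : IsCompact K)
    (h0 : (0 : EuclideanSpace ℝ (Fin N)) ∉ K)
    (u : EuclideanSpace ℝ (Fin N) → EuclideanSpace ℝ (Fin N)) (hu : ContDiff ℝ 2 u)
    (huK : ∀ x, x ∉ K → u x = 0) (a : ℝ) :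
    Integrable (fun x => (2 * ⟪u x, fderiv ℝ u x x⟫ + (N + a) * ‖u x‖ ^ 2) * ‖x‖ ^ a) ∧
    ∫ x, (2 * ⟪u x, fderiv ℝ u x x⟫ + (N + a) * ‖u x‖ ^ 2) * ‖x‖ ^ a = 0 := by
  have hF : ContDiff ℝ 1 (fun x => ‖u x‖ ^ 2 • x) :=
    ((hu.of_le (by norm_num)).norm_sq ℝ).smul contDiff_id
  have h := div_weight K hK h0 (fun x => ‖u x‖ ^ 2 • x) hF (fun x hx => by simp [huK x hx]) a
  have he : ∀ x, (∑ k, fderiv ℝ (fun x => ‖u x‖ ^ 2 • x) x (EuclideanSpace.single k 1) k) * ‖x‖ ^ a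
      + a * ⟪x, ‖u x‖ ^ 2 • x⟫ * ‖x‖ ^ (a - 2)
      = (2 * ⟪u x, fderiv ℝ u x x⟫ + (N + a) * ‖u x‖ ^ 2) * ‖x‖ ^ a := by
    intro x
    by_cases hx : x ∈ K
    swap
    · have := fderiv_zero_outside K hK.isClosed (fun x => ‖u x‖ ^ 2 • x)
        (fun x hx => by simp [huK x hx]) x hx
      rw [this, huK x hx]; simp
    have hx0 : x ≠ 0 := by rintro rfl; exact h0 hx
    have hd : HasFDerivAt u (fderiv ℝ u x) x := (hu.differentiable (by norm_num) x).hasFDerivAt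
    have hf := (hd.norm_sq.smul (hasFDerivAt_id x)).fderiv
    have hf' : fderiv ℝ (fun x => ‖u x‖ ^ 2 • x) x = _ := hf
    have e1 : ∑ k, fderiv ℝ (fun x => ‖u x‖ ^ 2 • x) x (EuclideanSpace.single k 1) k
        = 2 * ⟪u x, fderiv ℝ u x x⟫ + N * ‖u x‖ ^ 2 := by
      rw [hf']
      have e2 : ∀ k : Fin N, (‖u x‖ ^ 2 • ContinuousLinearMap.id ℝ (EuclideanSpace ℝ (Fin N)) +
          (2 • (innerSL ℝ (u x)).comp (fderiv ℝ u x)).smulRight (id x)) (EuclideanSpace.single k 1) k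
          = ‖u x‖ ^ 2 + 2 * (x k * ⟪u x, fderiv ℝ u x (EuclideanSpace.single k 1)⟫) := by
        intro k
        simp
        ring
      rw [Finset.sum_congr rfl fun k _ => e2 k, Finset.sum_add_distrib, ← Finset.mul_sum]
      have e3 : ∑ k, x k * ⟪u x, fderiv ℝ u x (EuclideanSpace.single k 1)⟫
          = ⟪u x, fderiv ℝ u x x⟫ := by
        conv_rhs => rw [← sum_single_smul x, map_sum, inner_sum, sum_single_smul x]
        refine Finset.sum_congr rfl fun k _ => ?_
        rw [map_smul, inner_smul_right]
      rw [e3]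
      simp; ring
    rw [e1, inner_smul_right, real_inner_self_eq_norm_sq, Real.rpow_sub (norm_pos_iff.2 hx0)]
    have : ‖x‖ ≠ 0 := norm_ne_zero_iff.2 hx0
    rw [Real.rpow_two]
    field_simp
    ring
  simpa only [he] using h

theorem D2 {N : ℕ} (K : Set (EuclideanSpace ℝ (Fin N))) (hK : IsCompact K)
    (h0 : (0 : EuclideanSpace ℝ (Fin N)) ∉ K)
    (u : EuclideanSpace ℝ (Fin N) → EuclideanSpace ℝ (Fin N)) (hu : ContDiff ℝ 2 u)
    (huK : ∀ x, x ∉ K → u x = 0)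
    (hdiv : ∀ x, ∑ k, fderiv ℝ u x (EuclideanSpace.single k 1) k = 0)
    (hxu : ∀ x, ⟪x, fderiv ℝ u x (u x)⟫ = - ‖u x‖ ^ 2) (a : ℝ) :
    Integrable (fun x => (∑ k, fderiv ℝ u x (fderiv ℝ u x (EuclideanSpace.single k 1)) k) * ‖x‖ ^ a
      + a * (-‖u x‖ ^ 2) * ‖x‖ ^ (a - 2)) ∧
    ∫ x, ((∑ k, fderiv ℝ u x (fderiv ℝ u x (EuclideanSpace.single k 1)) k) * ‖x‖ ^ a
      + a * (-‖u x‖ ^ 2) * ‖x‖ ^ (a - 2)) = 0 := by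
  have hdu : ContDiff ℝ 1 (fderiv ℝ u) := hu.fderiv_right (by norm_num)
  have hF : ContDiff ℝ 1 (fun x => fderiv ℝ u x (u x)) :=
    hdu.clm_apply (hu.of_le (by norm_num))
  have h := div_weight K hK h0 _ hF (fun x hx => by simp [huK x hx]) a
  have he : ∀ x, ∑ k, fderiv ℝ (fun x => fderiv ℝ u x (u x)) x (EuclideanSpace.single k 1) k
      = ∑ k, fderiv ℝ u x (fderiv ℝ u x (EuclideanSpace.single k 1)) k := by
    intro x
    have hd : HasFDerivAt u (fderiv ℝ u x) x := (hu.differentiable (by norm_num) x).hasFDerivAt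
    have hdd : HasFDerivAt (fderiv ℝ u) (fderiv ℝ (fderiv ℝ u) x) x :=
      (hdu.differentiable one_ne_zero x).hasFDerivAt
    have hf := (hdd.clm_apply hd).fderiv
    have hsym : IsSymmSndFDerivAt ℝ u x := hu.contDiffAt.isSymmSndFDerivAt (by simp)
    have e0 : ∑ k, fderiv ℝ (fderiv ℝ u) x (u x) (EuclideanSpace.single k 1) k = 0 := by
      have h1 : ∀ k : Fin N, HasFDerivAt (fun y => fderiv ℝ u y (EuclideanSpace.single k 1) k)
          ((EuclideanSpace.proj k : EuclideanSpace ℝ (Fin N) →L[ℝ] ℝ).comp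
            ((ContinuousLinearMap.apply ℝ _ (EuclideanSpace.single k (1:ℝ))).comp
              (fderiv ℝ (fderiv ℝ u) x))) x := by
        intro k
        have h4 : HasFDerivAt (fun y => fderiv ℝ u y (EuclideanSpace.single k 1))
            ((ContinuousLinearMap.apply ℝ _ (EuclideanSpace.single k (1:ℝ))).comp
              (fderiv ℝ (fderiv ℝ u) x)) x :=
          (ContinuousLinearMap.apply ℝ (EuclideanSpace ℝ (Fin N))
            (EuclideanSpace.single k (1:ℝ) : EuclideanSpace ℝ (Fin N))).hasFDerivAt.comp x hdd
        exact (EuclideanSpace.proj k : EuclideanSpace ℝ (Fin N) →L[ℝ] ℝ).hasFDerivAt.comp x h4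
      have h2 := HasFDerivAt.fun_sum (u := Finset.univ) fun k _ => h1 k
      simp only [hdiv] at h2
      have h3 := congrArg (fun L => L (u x)) (h2.unique (hasFDerivAt_const (0 : ℝ) x))
      simpa [sum_apply] using h3
    rw [hf]
    have e1 : ∀ k : Fin N, fderiv ℝ (fderiv ℝ u) x (EuclideanSpace.single k 1) (u x)
        = fderiv ℝ (fderiv ℝ u) x (u x) (EuclideanSpace.single k 1) := fun k => hsym _ _
    simp only [add_apply, ContinuousLinearMap.comp_apply,
      ContinuousLinearMap.flip_apply, PiLp.add_apply, e1, Finset.sum_add_distrib, e0, add_zero]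
  simpa only [he, hxu] using h


/-- Hardy–Leray inequality with remainder for toroidal fields. -/
theorem stmt16 (N : ℕ) (hN : 3 ≤ N) (γ : ℝ)
    (u : EuclideanSpace ℝ (Fin N) → EuclideanSpace ℝ (Fin N))
    (hu : ContDiffOn ℝ (⊤ : ℕ∞) u {(0 : EuclideanSpace ℝ (Fin N))}ᶜ)
    (hsupp : HasCompactSupport u)
    (hsupp' : tsupport u ⊆ {(0 : EuclideanSpace ℝ (Fin N))}ᶜ)
    (hsph : ∀ x : EuclideanSpace ℝ (Fin N), x ≠ 0 → ⟪x, u x⟫ = 0)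
    (hdiv : ∀ x : EuclideanSpace ℝ (Fin N), x ≠ 0 →
      ∑ k, fderiv ℝ u x (EuclideanSpace.single k 1) k = 0)
    (v : EuclideanSpace ℝ (Fin N) → EuclideanSpace ℝ (Fin N))
    (hv : ∀ x, v x = ‖x‖ ^ (γ + ((N : ℝ) - 2) / 2) • u x) :
    (∫ x : EuclideanSpace ℝ (Fin N),
        (∑ k, ‖fderiv ℝ u x (EuclideanSpace.single k 1)‖ ^ 2) * ‖x‖ ^ (2 * γ))
      - ((γ + ((N : ℝ) - 2) / 2) ^ 2 + (N : ℝ) - 1)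
          * (∫ x : EuclideanSpace ℝ (Fin N), ‖u x‖ ^ 2 * ‖x‖ ^ (2 * γ - 2))
      ≥ ∫ x : EuclideanSpace ℝ (Fin N),
          ‖fderiv ℝ v x x‖ ^ 2 * ‖x‖ ^ (-(N : ℝ)) := by
  set K := tsupport u with hKdef
  have hK : IsCompact K := hsupp
  have h0 : (0 : EuclideanSpace ℝ (Fin N)) ∉ K := fun h => hsupp' h rfl
  have huK : ∀ x, x ∉ K → u x = 0 := fun x hx => image_eq_zero_of_notMem_tsupport hx
  have hne : ∀ x ∈ K, x ≠ 0 := fun x hx => hsupp' hx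
  have hu0 : u 0 = 0 := huK 0 h0
  have hdu0 : ∀ x, x ∉ K → fderiv ℝ u x = 0 := fderiv_zero_outside K hK.isClosed u huK
  have hu2 : ContDiff ℝ 2 u := by
    rw [contDiff_iff_contDiffAt]
    intro x
    by_cases hx : x = 0
    · have : u =ᶠ[nhds x] fun _ => 0 := by
        filter_upwards [hK.isClosed.isOpen_compl.mem_nhds (hx ▸ h0 : x ∈ Kᶜ)] with y hy using huK y hy
      exact contDiffAt_const.congr_of_eventuallyEq this
    · exact ((hu.contDiffAt (isOpen_compl_singleton.mem_nhds hx)).of_le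
        (WithTop.coe_le_coe.2 (le_top : (2 : ℕ∞) ≤ ⊤)))
  have hdiv' : ∀ x, ∑ k, fderiv ℝ u x (EuclideanSpace.single k 1) k = 0 := by
    intro x
    by_cases hx : x = 0
    · subst hx; simp [hdu0 0 h0]
    · exact hdiv x hx
  have hsph' : ∀ x, ⟪x, u x⟫ = 0 := by
    intro x
    by_cases hx : x = 0
    · subst hx; simp
    · exact hsph x hx
  have hdiff : ∀ x, HasFDerivAt u (fderiv ℝ u x) x :=
    fun x => (hu2.differentiable (by norm_num) x).hasFDerivAt
  have hxA : ∀ x e, ⟪x, fderiv ℝ u x e⟫ = - ⟪e, u x⟫ := by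
    intro x e
    have h1 := (hasFDerivAt_id (𝕜 := ℝ) x).inner ℝ (hdiff x)
    simp only [id, hsph'] at h1
    have h3 := congrArg (fun L => L e) (h1.unique (hasFDerivAt_const (0 : ℝ) x))
    simp [fderivInnerCLM_apply] at h3
    linarith
  set s : ℝ := γ + ((N : ℝ) - 2) / 2 with hs
  have hvx : ∀ x, ‖fderiv ℝ v x x‖ ^ 2 * ‖x‖ ^ (-(N : ℝ))
      = ‖s • u x + fderiv ℝ u x x‖ ^ 2 * ‖x‖ ^ (2 * γ - 2) := by
    intro x
    by_cases hx : x ∈ K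
    · have hx0 := hne x hx
      have hpos : 0 < ‖x‖ := norm_pos_iff.2 hx0
      have hv' : v = fun x => ‖x‖ ^ s • u x := funext hv
      have hf := ((hasFDerivAt_weight s x hx0).smul (hdiff x)).fderiv
      have hv2 : fderiv ℝ v x = _ := (congrArg (fun f => fderiv ℝ f x) hv').trans hf
      clear hf
      have e1 : fderiv ℝ v x x = ‖x‖ ^ s • (s • u x + fderiv ℝ u x x) := by
        rw [hv2]
        simp only [add_apply, smul_apply, ContinuousLinearMap.smulRight_apply, innerSL_apply_apply,
          real_inner_self_eq_norm_sq, smul_eq_mul]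
        rw [Real.rpow_sub hpos, Real.rpow_two, smul_add, smul_smul, add_comm]
        congr 2
        field_simp
      rw [e1, norm_smul, mul_pow, Real.norm_of_nonneg (by positivity), ← Real.rpow_natCast (‖x‖ ^ s),
        ← Real.rpow_mul hpos.le, mul_right_comm, ← Real.rpow_add hpos, mul_comm]
      congr 2
      rw [hs]; push_cast; ring
    · have := fderiv_zero_outside K hK.isClosed v (fun y hy => by rw [hv, huK y hy, smul_zero]) x hx
      rw [this, hdu0 x hx, huK x hx]; simp
  simp only [hvx]
  have hcu : Continuous u := hu2.continuous
  have hcdu : Continuous (fderiv ℝ u) := hu2.continuous_fderiv (by norm_num)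
  have I1 : Integrable (fun x : EuclideanSpace ℝ (Fin N) => (∑ k, ‖fderiv ℝ u x (EuclideanSpace.single k 1)‖ ^ 2)
      * ‖x‖ ^ (2 * γ)) := by
    refine integrable_weight volume K hK h0 _ ?_ ?_ _
    · fun_prop
    · intro x hx; simp [hdu0 x hx]
  have I2 : Integrable (fun x : EuclideanSpace ℝ (Fin N) => ‖u x‖ ^ 2 * ‖x‖ ^ (2 * γ - 2)) := by
    refine integrable_weight volume K hK h0 _ ?_ ?_ _
    · fun_prop
    · intro x hx; simp [huK x hx]
  have I3 : Integrable (fun x : EuclideanSpace ℝ (Fin N) => ‖s • u x + fderiv ℝ u x x‖ ^ 2 * ‖x‖ ^ (2 * γ - 2)) := by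
    refine integrable_weight volume K hK h0 _ ?_ ?_ _
    · fun_prop
    · intro x hx; simp [huK x hx, hdu0 x hx]
  obtain ⟨J1, Z1⟩ := D1 K hK h0 u hu2 huK (2 * γ - 2)
  obtain ⟨J2, Z2⟩ := D2 K hK h0 u hu2 huK hdiv'
    (fun x => by rw [hxA, real_inner_self_eq_norm_sq]) (2 * γ)
  set c : ℝ := s ^ 2 + (N : ℝ) - 1 with hc
  have key : 0 ≤ ∫ x : EuclideanSpace ℝ (Fin N), (((∑ k, ‖fderiv ℝ u x (EuclideanSpace.single k 1)‖ ^ 2) * ‖x‖ ^ (2 * γ)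
      - c * (‖u x‖ ^ 2 * ‖x‖ ^ (2 * γ - 2))
      - ‖s • u x + fderiv ℝ u x x‖ ^ 2 * ‖x‖ ^ (2 * γ - 2))
      + (((∑ k, fderiv ℝ u x (fderiv ℝ u x (EuclideanSpace.single k 1)) k) * ‖x‖ ^ (2 * γ)
      + 2 * γ * (-‖u x‖ ^ 2) * ‖x‖ ^ (2 * γ - 2))
      + (1 + s) * ((2 * ⟪u x, fderiv ℝ u x x⟫ + (N + (2 * γ - 2)) * ‖u x‖ ^ 2)
        * ‖x‖ ^ (2 * γ - 2)))) := by
    refine integral_nonneg fun x => ?_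
    by_cases hx : x ∈ K
    swap
    · simp [huK x hx, hdu0 x hx]
    have hx0 := hne x hx
    have hpos : 0 < ‖x‖ := norm_pos_iff.2 hx0
    have hAj : ∀ y : EuclideanSpace ℝ (Fin N), ∀ j, fderiv ℝ u x y j
        = ∑ k, fderiv ℝ u x (EuclideanSpace.single k 1) j * y k := by
      intro y j
      conv_lhs => rw [← sum_single_smul y, map_sum]
      simp [mul_comm]
    have halg := alg_aux N (fun j k => fderiv ℝ u x (EuclideanSpace.single k 1) j)
      (fun j => x j) (fun j => u x j) (fun j => fderiv ℝ u x x j) (‖x‖ ^ 2) (by positivity)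
      (by rw [EuclideanSpace.real_norm_sq_eq]; exact Finset.sum_congr rfl fun _ _ => by ring)
      (by
        intro k
        have := hxA x (EuclideanSpace.single k 1)
        rw [EuclideanSpace.inner_single_left, PiLp.inner_apply] at this
        simpa [mul_comm] using this)
      (fun j => (hAj x j).symm)
      (by
        have := hsph' x
        rw [PiLp.inner_apply] at this
        simpa [mul_comm] using this)
    have r1 : ∑ k, ∑ j, fderiv ℝ u x (EuclideanSpace.single k 1) j ^ 2
        = ∑ k, ‖fderiv ℝ u x (EuclideanSpace.single k 1)‖ ^ 2 :=
      Finset.sum_congr rfl fun k _ => (EuclideanSpace.real_norm_sq_eq _).symm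
    have r2 : ∑ k, ∑ j, fderiv ℝ u x (EuclideanSpace.single k 1) j
          * fderiv ℝ u x (EuclideanSpace.single j 1) k
        = ∑ k, fderiv ℝ u x (fderiv ℝ u x (EuclideanSpace.single k 1)) k := by
      refine Finset.sum_congr rfl fun k _ => ?_
      rw [hAj (fderiv ℝ u x (EuclideanSpace.single k 1)) k]
      exact Finset.sum_congr rfl fun j _ => mul_comm _ _
    have r3 : ∑ j, u x j * fderiv ℝ u x x j = ⟪u x, fderiv ℝ u x x⟫ := by
      rw [PiLp.inner_apply]
      exact Finset.sum_congr rfl fun j _ => by simp [mul_comm]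
    rw [r1, r2, r3, ← EuclideanSpace.real_norm_sq_eq, ← EuclideanSpace.real_norm_sq_eq] at halg
    have hW : ‖x‖ ^ (2 * γ) = ‖x‖ ^ (2 * γ - 2) * ‖x‖ ^ 2 := by
      rw [← Real.rpow_two, ← Real.rpow_add hpos]; congr 1; ring
    have hWn : 0 ≤ ‖x‖ ^ (2 * γ - 2) := by positivity
    have hn : ‖s • u x + fderiv ℝ u x x‖ ^ 2 = s ^ 2 * ‖u x‖ ^ 2 + 2 * s * ⟪u x, fderiv ℝ u x x⟫
        + ‖fderiv ℝ u x x‖ ^ 2 := by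
      rw [norm_add_sq_real, norm_smul, mul_pow, Real.norm_eq_abs, sq_abs, real_inner_smul_left]
      ring
    have hm := mul_nonneg hWn halg
    simp only [Pi.zero_apply]
    rw [hn, hW]
    refine hm.trans (le_of_eq ?_)
    have hγ : γ = s - ((N : ℝ) - 2) / 2 := by rw [hs]; ring
    generalize ‖x‖ ^ (2 * γ - 2) = W
    rw [hc, hγ]
    ring
  have I12 := I1.sub (I2.const_mul c)
  have e1 := integral_add (I12.sub I3) (J2.add (J1.const_mul (1 + s)))
  have e2 := integral_sub I12 I3
  have e3 := integral_sub I1 (I2.const_mul c)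
  have e4 := integral_add J2 (J1.const_mul (1 + s))
  simp only [Pi.add_apply, Pi.sub_apply] at e1 e2 e3 e4
  rw [e1, e2, e3, e4, integral_const_mul, integral_const_mul, Z1, Z2] at key
  linarith
end

section
/- Let N ≥ 3 and γ ∈ ℝ, let ζ ∈ C_c^∞(ℝ) with ζ ≢ 0, and for n ∈ ℕ define the toroidal field u_n(x) = |x|^{-γ-(N-2)/2} ζ(log|x|/n) v(x/|x|) where v(y) = (-y₂, y₁, 0, …, 0). Then the Hardy–Leray quotient ∫|∇u_n|²|x|^{2γ}dx / ∫|u_n|²|x|^{2γ-2}dx equals (γ+(N-2)/2)² + N - 1 + (1/n²)·(∫ζ'(s)²ds / ∫ζ(s)²ds), and hence converges to (γ+(N-2)/2)² + N - 1 as n → ∞. Consequently the constant (γ+(N-2)/2)² + N - 1 is sharp in the Hardy–Leray inequality for toroidal fields. -/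
open MeasureTheory Filter
open scoped BigOperators Topology

/-- Radial integration against `|x|^{-N}`, in logarithmic coordinates. -/
lemma radial_log (N : ℕ) (hN : 3 ≤ N) (Z : ℝ → ℝ) (hZ : Continuous Z)
    (hZc : HasCompactSupport Z) :
    Integrable (fun x : EuclideanSpace ℝ (Fin N) => (‖x‖ ^ N)⁻¹ * Z (Real.log ‖x‖)) ∧
    ∫ x : EuclideanSpace ℝ (Fin N), (‖x‖ ^ N)⁻¹ * Z (Real.log ‖x‖) =
      ((N : ℝ) * (volume : Measure (EuclideanSpace ℝ (Fin N))).real (Metric.ball 0 1)) *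
        ∫ s, Z s := by
  have : Nonempty (Fin N) := ⟨⟨0, by omega⟩⟩
  have : Nontrivial (EuclideanSpace ℝ (Fin N)) := inferInstance
  have himg : Real.exp '' Set.univ = Set.Ioi 0 := by
    rw [Set.image_univ, Real.range_exp]
  have hd : ∀ x ∈ (Set.univ : Set ℝ), HasDerivWithinAt Real.exp (Real.exp x) Set.univ x :=
    fun x _ => (Real.hasDerivAt_exp x).hasDerivWithinAt
  have hinj : Set.InjOn Real.exp Set.univ := Real.exp_injective.injOn
  have hfun : (fun s : ℝ => |Real.exp s| • (Real.exp s ^ (N - 1) •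
      ((Real.exp s ^ N)⁻¹ * Z (Real.log (Real.exp s))))) = Z := by
    funext s
    have h0 : Real.exp s ≠ 0 := (Real.exp_pos s).ne'
    obtain ⟨M, rfl⟩ : ∃ M, N = M + 1 := ⟨N - 1, by omega⟩
    rw [abs_of_pos (Real.exp_pos s), Real.log_exp]
    simp only [smul_eq_mul, Nat.add_sub_cancel]
    field_simp
    ring
  constructor
  · rw [integrable_fun_norm_addHaar volume (f := fun r : ℝ => (r ^ N)⁻¹ * Z (Real.log r)),
      finrank_euclideanSpace_fin, ← himg,
      integrableOn_image_iff_integrableOn_abs_deriv_smul MeasurableSet.univ hd hinj, hfun]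
    exact (hZ.integrable_of_hasCompactSupport hZc).integrableOn
  · rw [integral_fun_norm_addHaar volume (fun r : ℝ => (r ^ N)⁻¹ * Z (Real.log r)),
      finrank_euclideanSpace_fin, ← himg,
      integral_image_eq_integral_abs_deriv_smul MeasurableSet.univ hd hinj, hfun,
      setIntegral_univ]
    simp [mul_assoc]

/-- Averaging of the squared direction cosine. -/
lemma coord_avg (N : ℕ) (hN : 3 ≤ N) (Z : ℝ → ℝ) (hZ : Continuous Z)
    (hZc : HasCompactSupport Z) (i : Fin N) :
    Integrable (fun x : EuclideanSpace ℝ (Fin N) =>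
      (‖x‖ ^ N)⁻¹ * Z (Real.log ‖x‖) * (‖x‖⁻¹ * x i) ^ 2) ∧
    ∫ x : EuclideanSpace ℝ (Fin N), (‖x‖ ^ N)⁻¹ * Z (Real.log ‖x‖) * (‖x‖⁻¹ * x i) ^ 2 =
      (volume : Measure (EuclideanSpace ℝ (Fin N))).real (Metric.ball 0 1) * ∫ s, Z s := by
  have : Nonempty (Fin N) := ⟨⟨0, by omega⟩⟩
  have : Nontrivial (EuclideanSpace ℝ (Fin N)) := inferInstance
  obtain ⟨hI, hE⟩ := radial_log N hN Z hZ hZc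
  have hint : ∀ j : Fin N, Integrable (fun x : EuclideanSpace ℝ (Fin N) =>
      (‖x‖ ^ N)⁻¹ * Z (Real.log ‖x‖) * (‖x‖⁻¹ * x j) ^ 2) := by
    intro j
    refine hI.mono ?_ (Eventually.of_forall fun x => ?_)
    · refine hI.aestronglyMeasurable.mul (Measurable.aestronglyMeasurable ?_)
      have : Measurable fun x : EuclideanSpace ℝ (Fin N) => x j := by
        have : Continuous fun x : EuclideanSpace ℝ (Fin N) => x j := by fun_prop
        exact this.measurable
      fun_prop
    · rw [norm_mul]
      refine mul_le_of_le_one_right (norm_nonneg _) ?_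
      rw [norm_pow, norm_mul, norm_inv, norm_norm]
      have h1 : ‖x j‖ ≤ ‖x‖ := PiLp.norm_apply_le x j
      refine pow_le_one₀ (by positivity) ?_
      rw [inv_mul_eq_div]
      exact div_le_one_of_le₀ h1 (norm_nonneg _)
  refine ⟨hint i, ?_⟩
  have hsym : ∀ j : Fin N,
      ∫ x : EuclideanSpace ℝ (Fin N), (‖x‖ ^ N)⁻¹ * Z (Real.log ‖x‖) * (‖x‖⁻¹ * x j) ^ 2 =
      ∫ x : EuclideanSpace ℝ (Fin N), (‖x‖ ^ N)⁻¹ * Z (Real.log ‖x‖) * (‖x‖⁻¹ * x i) ^ 2 := by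
    intro j
    let T := LinearIsometryEquiv.piLpCongrLeft 2 ℝ ℝ (Equiv.swap i j)
    have := (LinearIsometryEquiv.measurePreserving T).integral_comp
      T.toHomeomorph.measurableEmbedding
      (fun x : EuclideanSpace ℝ (Fin N) => (‖x‖ ^ N)⁻¹ * Z (Real.log ‖x‖) * (‖x‖⁻¹ * x i) ^ 2)
    rw [← this]
    congr 1
    funext x
    have h2 : T x i = x j := by
      simp [T, LinearIsometryEquiv.piLpCongrLeft_apply, Equiv.piCongrLeft']
    rw [LinearIsometryEquiv.norm_map, h2]
  have hsum : ∑ j : Fin N,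
      ∫ x : EuclideanSpace ℝ (Fin N), (‖x‖ ^ N)⁻¹ * Z (Real.log ‖x‖) * (‖x‖⁻¹ * x j) ^ 2 =
      ∫ x : EuclideanSpace ℝ (Fin N), (‖x‖ ^ N)⁻¹ * Z (Real.log ‖x‖) := by
    rw [← integral_finsetSum _ (fun j _ => hint j)]
    refine integral_congr_ae ?_
    filter_upwards [Measure.ae_ne volume (0 : EuclideanSpace ℝ (Fin N))] with x hx
    rw [← Finset.mul_sum]
    have : ∑ j, (‖x‖⁻¹ * x j) ^ 2 = 1 := by
      simp_rw [mul_pow]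
      rw [← Finset.mul_sum, ← EuclideanSpace.real_norm_sq_eq]
      have := norm_ne_zero_iff.2 hx
      field_simp
    rw [this, mul_one]
  simp_rw [hsym] at hsum
  rw [Finset.sum_const, Finset.card_univ, Fintype.card_fin, nsmul_eq_mul, hE] at hsum
  have hN0 : (N : ℝ) ≠ 0 := by positivity
  have : (N : ℝ) ≠ 0 := by
    have : (N : ℕ) ≠ 0 := by omega
    exact_mod_cast this
  rw [mul_assoc] at hsum
  exact mul_left_cancel₀ this hsum

/-- The one-dimensional computation. -/
lemma one_dim (ζ : ℝ → ℝ) (hζ : ContDiff ℝ (⊤ : ℕ∞) ζ) (hζc : HasCompactSupport ζ)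
    (c : ℝ) (n : ℝ) (hn : 0 < n) :
    ∫ s : ℝ, ((c * ζ (s / n) + deriv ζ (s / n) / n) ^ 2 - ζ (s / n) ^ 2) =
      n * ((c ^ 2 - 1) * (∫ s, ζ s ^ 2) + 1 / n ^ 2 * ∫ s, deriv ζ s ^ 2) := by
  have hc : Continuous ζ := hζ.continuous
  have hdc : Continuous (deriv ζ) := hζ.continuous_deriv (by simp)
  have hds : HasCompactSupport (deriv ζ) := hζc.deriv
  rw [Measure.integral_comp_div (fun t => (c * ζ t + deriv ζ t / n) ^ 2 - ζ t ^ 2) n,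
    abs_of_pos hn, smul_eq_mul]
  congr 1
  have i1 : Integrable (fun s => ζ s ^ 2) :=
    (hc.pow 2).integrable_of_hasCompactSupport (by
      simpa [pow_two] using! hζc.mul_left (f := ζ))
  have i2 : Integrable (fun s => deriv ζ s ^ 2) :=
    (hdc.pow 2).integrable_of_hasCompactSupport (by
      simpa [pow_two] using! hds.mul_left (f := deriv ζ))
  have i3 : Integrable (fun s => ζ s * deriv ζ s) :=
    (hc.mul hdc).integrable_of_hasCompactSupport (hds.mul_left)
  have i4 : Integrable (fun s => deriv ζ s * ζ s) :=
    (hdc.mul hc).integrable_of_hasCompactSupport (hζc.mul_left)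
  have hder : ∀ x, HasDerivAt ζ (deriv ζ x) x := fun x =>
    (hζ.differentiable (by simp) x).hasDerivAt
  have hz : ∫ s, ζ s * deriv ζ s = 0 := by
    have := integral_mul_deriv_eq_deriv_mul_of_integrable (u := ζ) (v := ζ) (u' := deriv ζ)
      (v' := deriv ζ) (fun x _ => hder x) (fun x _ => hder x) i3 i4
      (by simpa [pow_two] using! i1)
    have h2 : ∫ s, deriv ζ s * ζ s = ∫ s, ζ s * deriv ζ s := by
      congr 1; funext s; ring
    rw [h2] at this
    linarith
  have : (fun t => (c * ζ t + deriv ζ t / n) ^ 2 - ζ t ^ 2) = fun t =>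
      ((c ^ 2 - 1) * ζ t ^ 2 + 1 / n ^ 2 * deriv ζ t ^ 2) + (2 * c / n) * (ζ t * deriv ζ t) := by
    funext t
    field_simp
    ring
  have i12 : Integrable (fun t => (c ^ 2 - 1) * ζ t ^ 2 + 1 / n ^ 2 * deriv ζ t ^ 2) :=
    (i1.const_mul _).add (i2.const_mul _)
  rw [this, integral_add i12 (i3.const_mul _),
    integral_add (i1.const_mul _) (i2.const_mul _), integral_const_mul, integral_const_mul,
    integral_const_mul, hz]
  ring

/-- Rotation generator in the plane spanned by the coordinates `i`, `j`. -/
noncomputable def rotJ {N : ℕ} (i j : Fin N) :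
    EuclideanSpace ℝ (Fin N) →L[ℝ] EuclideanSpace ℝ (Fin N) :=
  (EuclideanSpace.proj i : EuclideanSpace ℝ (Fin N) →L[ℝ] ℝ).smulRight (EuclideanSpace.single j 1)
  - (EuclideanSpace.proj j : EuclideanSpace ℝ (Fin N) →L[ℝ] ℝ).smulRight
      (EuclideanSpace.single i 1)

lemma rotJ_apply {N : ℕ} (i j : Fin N) (w : EuclideanSpace ℝ (Fin N)) :
    rotJ i j w = w i • EuclideanSpace.single j (1 : ℝ) - w j • EuclideanSpace.single i (1 : ℝ) := by
  simp [rotJ]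

lemma rotJ_norm {N : ℕ} (i j : Fin N) (h : i ≠ j) (w : EuclideanSpace ℝ (Fin N)) :
    ‖rotJ i j w‖ ^ 2 = w i ^ 2 + w j ^ 2 := by
  rw [rotJ_apply, norm_sub_sq_real, norm_smul, norm_smul, inner_smul_left, inner_smul_right]
  simp [EuclideanSpace.inner_single_left, h]

lemma hasFDerivAt_norm_aux {N : ℕ} (x : EuclideanSpace ℝ (Fin N)) (hx : x ≠ 0) :
    HasFDerivAt (fun y : EuclideanSpace ℝ (Fin N) => ‖y‖) (‖x‖⁻¹ • innerSL ℝ x) x := by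
  have h := (hasStrictFDerivAt_norm_sq x).hasFDerivAt.sqrt
    (pow_ne_zero 2 (norm_ne_zero_iff.2 hx))
  simp only [Real.sqrt_sq (norm_nonneg _)] at h
  refine h.congr_fderiv ?_
  ext y
  simp
  field_simp

lemma grad_sq {N : ℕ} (i j : Fin N) (h : i ≠ j) (G : ℝ → ℝ) (G' : ℝ)
    (x : EuclideanSpace ℝ (Fin N)) (hx : x ≠ 0) (hG : HasDerivAt G G' ‖x‖) :
    ∑ k, ‖fderiv ℝ (fun y => G ‖y‖ • rotJ i j y) x (EuclideanSpace.single k 1)‖ ^ 2 =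
      (G' ^ 2 + 2 * G' * G ‖x‖ * ‖x‖⁻¹) * (x i ^ 2 + x j ^ 2) + 2 * G ‖x‖ ^ 2 := by
  have h1 : HasFDerivAt (fun y : EuclideanSpace ℝ (Fin N) => G ‖y‖)
      (G' • (‖x‖⁻¹ • innerSL ℝ x)) x :=
    hG.comp_hasFDerivAt x (hasFDerivAt_norm_aux x hx)
  have h2 : HasFDerivAt (fun y => G ‖y‖ • rotJ i j y)
      (G ‖x‖ • rotJ i j + (G' • (‖x‖⁻¹ • innerSL ℝ x)).smulRight (rotJ i j x)) x :=
    h1.smul (rotJ i j).hasFDerivAt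
  rw [h2.fderiv]
  set A := G' * ‖x‖⁻¹ with hA
  set g := G ‖x‖ with hg
  have hk : ∀ k : Fin N,
      ‖(g • rotJ i j + (G' • (‖x‖⁻¹ • innerSL ℝ x)).smulRight (rotJ i j x))
        (EuclideanSpace.single k 1)‖ ^ 2 =
      A ^ 2 * (x i ^ 2 + x j ^ 2) * x k ^ 2
        + (if k = i then 2 * A * g * x i ^ 2 + g ^ 2 else 0)
        + (if k = j then 2 * A * g * x j ^ 2 + g ^ 2 else 0) := by
    intro k
    have : (g • rotJ i j + (G' • (‖x‖⁻¹ • innerSL ℝ x)).smulRight (rotJ i j x))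
        (EuclideanSpace.single k 1) =
        rotJ i j (g • EuclideanSpace.single k 1 + (A * x k) • x) := by
      rw [map_add, map_smul, map_smul]
      simp [EuclideanSpace.inner_single_right, hA, mul_assoc]
    rw [this, rotJ_norm i j h]
    by_cases hki : k = i
    · subst hki
      simp [h, h.symm]
      ring
    · by_cases hkj : k = j
      · subst hkj
        simp [h, h.symm]
        ring
      · simp [hki, hkj, Ne.symm hki, Ne.symm hkj]
        ring
  simp_rw [hk]
  rw [Finset.sum_add_distrib, Finset.sum_add_distrib, ← Finset.mul_sum,
    ← EuclideanSpace.real_norm_sq_eq]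
  simp only [Finset.sum_ite_eq', Finset.mem_univ, if_true]
  have := norm_ne_zero_iff.2 hx
  rw [hA]
  field_simp
  ring



/-- the explicit toroidal test sequence
`u_n(x) = |x|^{-γ-(N-2)/2} ζ(log|x|/n) v(x/|x|)`, `v(y) = (-y₂, y₁, 0, …, 0)`,
has Hardy–Leray quotient exactly
`(γ+(N-2)/2)² + N - 1 + n⁻²·(∫ζ'²/∫ζ²)`, which converges to
`(γ+(N-2)/2)² + N - 1`; hence this constant is sharp for toroidal fields. -/
theorem stmt19 (N : ℕ) (hN : 3 ≤ N) (γ : ℝ)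
    (ζ : ℝ → ℝ) (hζ : ContDiff ℝ (⊤ : ℕ∞) ζ) (hζc : HasCompactSupport ζ)
    (hζ0 : ζ ≠ 0)
    (u : ℕ → EuclideanSpace ℝ (Fin N) → EuclideanSpace ℝ (Fin N))
    (hu : ∀ (n : ℕ) (x : EuclideanSpace ℝ (Fin N)) (i : Fin N),
      u n x i = ‖x‖ ^ (-γ - ((N : ℝ) - 2) / 2) * ζ (Real.log ‖x‖ / n) *
        (if i = (⟨0, by omega⟩ : Fin N) then -(‖x‖⁻¹ * x ⟨1, by omega⟩)
         else if i = (⟨1, by omega⟩ : Fin N) then ‖x‖⁻¹ * x ⟨0, by omega⟩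
         else 0))
    (Q : ℕ → ℝ)
    (hQ : ∀ n : ℕ, Q n =
      (∫ x : EuclideanSpace ℝ (Fin N),
          (∑ k, ‖fderiv ℝ (u n) x (EuclideanSpace.single k 1)‖ ^ 2)
            * ‖x‖ ^ (2 * γ))
        / ∫ x : EuclideanSpace ℝ (Fin N), ‖u n x‖ ^ 2 * ‖x‖ ^ (2 * γ - 2)) :
    (∀ n : ℕ, 0 < n →
      Q n = (γ + ((N : ℝ) - 2) / 2) ^ 2 + (N : ℝ) - 1
        + 1 / (n : ℝ) ^ 2 * ((∫ s : ℝ, (deriv ζ s) ^ 2) / ∫ s : ℝ, (ζ s) ^ 2)) ∧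
    Tendsto Q atTop (𝓝 ((γ + ((N : ℝ) - 2) / 2) ^ 2 + (N : ℝ) - 1)) := by
  have key : ∀ n : ℕ, 0 < n →
      Q n = (γ + ((N : ℝ) - 2) / 2) ^ 2 + (N : ℝ) - 1
        + 1 / (n : ℝ) ^ 2 * ((∫ s : ℝ, (deriv ζ s) ^ 2) / ∫ s : ℝ, (ζ s) ^ 2) := by
    intro n hn
    have hn' : (0 : ℝ) < n := by exact_mod_cast hn
    have hne : Nonempty (Fin N) := ⟨⟨0, by omega⟩⟩
    have hnt : Nontrivial (EuclideanSpace ℝ (Fin N)) := inferInstance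
    obtain ⟨i, hi⟩ : ∃ i : Fin N, i = ⟨0, by omega⟩ := ⟨_, rfl⟩
    obtain ⟨j, hj⟩ : ∃ j : Fin N, j = ⟨1, by omega⟩ := ⟨_, rfl⟩
    have hij : i ≠ j := by rw [hi, hj]; simp
    set c : ℝ := -γ - ((N : ℝ) - 2) / 2 with hc
    have hzc : Continuous ζ := hζ.continuous
    have hdc : Continuous (deriv ζ) := hζ.continuous_deriv (by simp)
    have hds : HasCompactSupport (deriv ζ) := hζc.deriv
    have hder : ∀ x, HasDerivAt ζ (deriv ζ x) x := fun x =>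
      (hζ.differentiable (by simp) x).hasDerivAt
    -- the field as a radial multiple of a rotation
    have hun : u n = fun x => (‖x‖ ^ c * ζ (Real.log ‖x‖ / n) * ‖x‖⁻¹) • rotJ i j x := by
      funext x
      ext k
      rw [hu, rotJ_apply, ← hi, ← hj]
      by_cases hki : k = i
      · subst hki
        simp [hij, hij.symm]
        ring
      · by_cases hkj : k = j
        · subst hkj
          simp [hij, hij.symm]
          ring
        · simp [hki, hkj]
    -- powers
    have hpow : ∀ r : ℝ, 0 < r → (r ^ c) ^ 2 * r ^ (2 * γ) = r ^ 2 * (r ^ N)⁻¹ := by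
      intro r hr
      rw [← Real.rpow_natCast r N, ← Real.rpow_neg hr.le, ← Real.rpow_natCast r 2,
        ← Real.rpow_natCast (r ^ c) 2, ← Real.rpow_mul hr.le, ← Real.rpow_add hr,
        ← Real.rpow_add hr]
      congr 1
      rw [hc]; push_cast; ring
    -- the profile functions
    set Z1 : ℝ → ℝ := fun s =>
      (c * ζ (s / n) + deriv ζ (s / n) / n) ^ 2 - ζ (s / n) ^ 2 with hZ1
    set Z2 : ℝ → ℝ := fun s => ζ (s / n) ^ 2 with hZ2
    have hscale : ∀ f : ℝ → ℝ, HasCompactSupport f →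
        HasCompactSupport (fun s : ℝ => f (s / n)) := by
      intro f hf
      exact hf.comp_homeomorph (Homeomorph.mulRight₀ ((n : ℝ)⁻¹) (inv_ne_zero hn'.ne'))
    have hZ1c : Continuous Z1 := by fun_prop
    have hZ2c : Continuous Z2 := by fun_prop
    have hZ2s : HasCompactSupport Z2 :=
      (hscale ζ hζc).comp_left (g := fun t : ℝ => t ^ 2) (by simp)
    have hZ1s : HasCompactSupport Z1 := by
      have h1 : HasCompactSupport (fun s : ℝ => c * ζ (s / n) + deriv ζ (s / n) / n) :=
        ((hscale ζ hζc).comp_left (g := fun t : ℝ => c * t) (by simp)).add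
          ((hscale _ hds).comp_left (g := fun t : ℝ => t / n) (by simp))
      exact (h1.comp_left (g := fun t : ℝ => t ^ 2) (by simp)).sub hZ2s
    obtain ⟨r2I, r2E⟩ := radial_log N hN Z2 hZ2c hZ2s
    obtain ⟨a1I, a1E⟩ := coord_avg N hN Z1 hZ1c hZ1s i
    obtain ⟨b1I, b1E⟩ := coord_avg N hN Z1 hZ1c hZ1s j
    obtain ⟨a2I, a2E⟩ := coord_avg N hN Z2 hZ2c hZ2s i
    obtain ⟨b2I, b2E⟩ := coord_avg N hN Z2 hZ2c hZ2s j
    set V := (volume : Measure (EuclideanSpace ℝ (Fin N))).real (Metric.ball 0 1) with hV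
    have hVpos : 0 < V := by
      rw [hV, Measure.real, ENNReal.toReal_pos_iff]
      exact ⟨Metric.measure_ball_pos _ _ one_pos, measure_ball_lt_top⟩
    have hnum : (∫ x : EuclideanSpace ℝ (Fin N),
          (∑ k, ‖fderiv ℝ (u n) x (EuclideanSpace.single k 1)‖ ^ 2) * ‖x‖ ^ (2 * γ)) =
        V * (∫ s, Z1 s) + V * (∫ s, Z1 s) + 2 * ((N * V) * ∫ s, Z2 s) := by
      rw [← r2E]
      nth_rewrite 1 [← a1E]
      have abI : Integrable (fun x : EuclideanSpace ℝ (Fin N) =>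
          (‖x‖ ^ N)⁻¹ * Z1 (Real.log ‖x‖) * (‖x‖⁻¹ * x i) ^ 2 +
          (‖x‖ ^ N)⁻¹ * Z1 (Real.log ‖x‖) * (‖x‖⁻¹ * x j) ^ 2) := a1I.add b1I
      rw [← b1E, ← integral_const_mul, ← integral_add a1I b1I,
        ← integral_add abI (r2I.const_mul 2)]
      refine integral_congr_ae ?_
      filter_upwards [Measure.ae_ne volume (0 : EuclideanSpace ℝ (Fin N))] with x hx
      have hr : 0 < ‖x‖ := norm_pos_iff.2 hx
      have hG : HasDerivAt (fun r : ℝ => r ^ c * ζ (Real.log r / n) * r⁻¹)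
          (‖x‖ ^ c * ‖x‖⁻¹ * ‖x‖⁻¹ * ((c - 1) * ζ (Real.log ‖x‖ / n)
            + deriv ζ (Real.log ‖x‖ / n) / n)) ‖x‖ := by
        have d1 := Real.hasDerivAt_rpow_const (p := c) (Or.inl hr.ne')
        have d2 := (hder (Real.log ‖x‖ / n)).comp ‖x‖
          ((Real.hasDerivAt_log hr.ne').div_const (n : ℝ))
        have d3 := (d1.mul d2).mul (hasDerivAt_inv hr.ne')
        refine d3.congr_deriv ?_
        rw [Real.rpow_sub_one hr.ne']
        simp only [Function.comp, Pi.mul_apply]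
        field_simp
        ring
      rw [hun, grad_sq i j hij (fun r : ℝ => r ^ c * ζ (Real.log r / n) * r⁻¹) _ x hx hG]
      have hp := hpow ‖x‖ hr
      simp only [hZ1, hZ2]
      generalize ζ (Real.log ‖x‖ / n) = p
      generalize deriv ζ (Real.log ‖x‖ / n) / n = q
      generalize (‖x‖ ^ N)⁻¹ = E at *
      generalize ‖x‖ ^ c = R at *
      generalize ‖x‖ ^ (2 * γ) = S at *
      generalize ‖x‖ = r at *
      have hE : E = R ^ 2 * S / r ^ 2 := by rw [hp]; field_simp
      rw [hE]
      field_simp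
      ring
    have hden : (∫ x : EuclideanSpace ℝ (Fin N), ‖u n x‖ ^ 2 * ‖x‖ ^ (2 * γ - 2)) =
        V * (∫ s, Z2 s) + V * (∫ s, Z2 s) := by
      nth_rewrite 1 [← a2E]
      rw [← b2E, ← integral_add a2I b2I]
      refine integral_congr_ae ?_
      filter_upwards [Measure.ae_ne volume (0 : EuclideanSpace ℝ (Fin N))] with x hx
      have hr : 0 < ‖x‖ := norm_pos_iff.2 hx
      have hp := hpow ‖x‖ hr
      have hs : ‖x‖ ^ (2 * γ - 2) = ‖x‖ ^ (2 * γ) / ‖x‖ ^ 2 := by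
        rw [Real.rpow_sub hr, Real.rpow_two]
      rw [hun]
      simp only [norm_smul, mul_pow, rotJ_norm i j hij, Real.norm_eq_abs, sq_abs]
      rw [hs]
      simp only [hZ2]
      generalize ζ (Real.log ‖x‖ / n) = p
      generalize (‖x‖ ^ N)⁻¹ = E at *
      generalize ‖x‖ ^ c = R at *
      generalize ‖x‖ ^ (2 * γ) = S at *
      generalize ‖x‖ = r at *
      have hE : E = R ^ 2 * S / r ^ 2 := by rw [hp]; field_simp
      rw [hE]
      field_simp
    have e1 : ∫ s, Z1 s = n * ((c ^ 2 - 1) * (∫ s, ζ s ^ 2) + 1 / (n : ℝ) ^ 2 *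
        ∫ s, deriv ζ s ^ 2) := one_dim ζ hζ hζc c n hn'
    have e2 : ∫ s, Z2 s = n * ∫ s, ζ s ^ 2 := by
      rw [hZ2, Measure.integral_comp_div (fun t => ζ t ^ 2) (n : ℝ), abs_of_pos hn', smul_eq_mul]
    have hpos : 0 < ∫ s, ζ s ^ 2 := by
      obtain ⟨s0, hs0⟩ := Function.ne_iff.1 hζ0
      refine Continuous.integral_pos_of_hasCompactSupport_nonneg_nonzero (x := s0)
        (hzc.pow 2) (hζc.comp_left (g := fun t : ℝ => t ^ 2) (by simp))
        (fun s => sq_nonneg _) (pow_ne_zero 2 hs0)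
    have hcc : (γ + ((N : ℝ) - 2) / 2) ^ 2 = c ^ 2 := by rw [hc]; ring
    rw [hQ, hnum, hden, e1, e2, hcc]
    generalize (∫ s, ζ s ^ 2) = I at *
    generalize (∫ s, deriv ζ s ^ 2) = D at *
    field_simp
    ring
  refine ⟨key, ?_⟩
  have hlim : Tendsto (fun n : ℕ => (γ + ((N : ℝ) - 2) / 2) ^ 2 + (N : ℝ) - 1
        + 1 / (n : ℝ) ^ 2 * ((∫ s : ℝ, (deriv ζ s) ^ 2) / ∫ s : ℝ, (ζ s) ^ 2)) atTop
      (𝓝 ((γ + ((N : ℝ) - 2) / 2) ^ 2 + (N : ℝ) - 1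
        + 0 * ((∫ s : ℝ, (deriv ζ s) ^ 2) / ∫ s : ℝ, (ζ s) ^ 2))) := by
    refine tendsto_const_nhds.add (Tendsto.mul_const _ ?_)
    have := tendsto_one_div_atTop_nhds_zero_nat (𝕜 := ℝ)
    simpa using! this.pow 2
  rw [zero_mul, add_zero] at hlim
  refine hlim.congr' ?_
  filter_upwards [eventually_gt_atTop 0] with n hn
  exact (key n hn).symm
end
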